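/- Let q be an odd prime power and F = GF(q). Let W be the 4-dimensional subspace of quadratic forms over F spanned by X0X1, X0X2, X1X2 and X1^2+X2^2 (the web of conics associated with the line-orbit o_{8,1}). Then among the conics of W there are exactly 2 double lines, exactly q^2+(3q−1)/2 pairs of real lines, exactly (q−1)/2 pairs of imaginary lines, and exactly q^3−q nonsingular conics. -/

import Mathlib

open Matrix

namespace Conics

/-- Coefficient vector (a0,...,a5) of the product of two linear forms
`(b0*X0+b1*X1+b2*X2)*(c0*X0+c1*X1+c2*X2)`, where the quadratic form with
coefficient vector `a` is `a0*X0^2 + a1*X0*X1 + a2*X0*X2 + a3*X1^2 + a4*X1*X2 + a5*X2^2`. -/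
def mulLin {F : Type} [Field F] (b c : Fin 3 → F) : Fin 6 → F :=
  ![b 0 * c 0, b 0 * c 1 + b 1 * c 0, b 0 * c 2 + b 2 * c 0,
    b 1 * c 1, b 1 * c 2 + b 2 * c 1, b 2 * c 2]

/-- The discriminant of the quadratic form with coefficient vector `a`. -/
def disc {F : Type} [Field F] (a : Fin 6 → F) : F :=
  4 * a 0 * a 3 * a 5 + a 1 * a 2 * a 4 - a 0 * a 4 ^ 2 - a 3 * a 2 ^ 2 - a 5 * a 1 ^ 2

/-- `f_a` is a double line: `f_a = c * l^2` for a nonzero scalar `c` and nonzero linear form `l`. -/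
def IsDoubleLine {F : Type} [Field F] (a : Fin 6 → F) : Prop :=
  ∃ (c : F) (l : Fin 3 → F), c ≠ 0 ∧ l ≠ 0 ∧ a = c • mulLin l l

/-- `f_a` is a pair of (distinct) real lines: `f_a = l1 * l2` with neither linear form a scalar
multiple of the other. -/
def IsRealPair {F : Type} [Field F] (a : Fin 6 → F) : Prop :=
  ∃ l1 l2 : Fin 3 → F, (¬ ∃ t : F, l2 = t • l1) ∧ (¬ ∃ t : F, l1 = t • l2) ∧ a = mulLin l1 l2

/-- `f_a` is a pair of conjugate imaginary lines: singular, but not a product of two linear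
forms over `F`. -/
def IsImagPair {F : Type} [Field F] (a : Fin 6 → F) : Prop :=
  disc a = 0 ∧ ¬ ∃ l1 l2 : Fin 3 → F, a = mulLin l1 l2

/-- `f_a` is a nonsingular conic. -/
def IsNonsingular {F : Type} [Field F] (a : Fin 6 → F) : Prop :=
  disc a ≠ 0

/-- The number of conics of a given type `T` in a linear system `W` (a subspace of the space of
quadratic forms, identified with `F^6`): the number of 1-dimensional subspaces `⟨a⟩` of `W`,
`a ≠ 0`, such that `f_a` has type `T`. -/
noncomputable def numConics {F : Type} [Field F] (W : Submodule F (Fin 6 → F))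
    (T : (Fin 6 → F) → Prop) : ℕ :=
  Set.ncard {P : Submodule F (Fin 6 → F) |
    ∃ a : Fin 6 → F, a ≠ 0 ∧ a ∈ W ∧ T a ∧ P = Submodule.span F {a}}

/-- The symmetric 3×3 matrix associated with a point `y` of `PG(5,q)`. -/
def M {F : Type} [Field F] (y : Fin 6 → F) : Matrix (Fin 3) (Fin 3) F :=
  !![y 0, y 1, y 2; y 1, y 3, y 4; y 2, y 4, y 5]

/-- The pairing `B(a,y) = a0*y0 + ... + a5*y5`. -/
def Bform {F : Type} [Field F] (a y : Fin 6 → F) : F :=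
  a 0 * y 0 + a 1 * y 1 + a 2 * y 2 + a 3 * y 3 + a 4 * y 4 + a 5 * y 5

/-- The squab of conics associated with a (nonzero) point `y`: the hyperplane
`{a : B(a,y) = 0}` of the space of quadratic forms. -/
def squab {F : Type} [Field F] (y : Fin 6 → F) : Submodule F (Fin 6 → F) where
  carrier := {a | Bform a y = 0}
  add_mem' := by
    intro a b ha hb
    simp only [Set.mem_setOf_eq, Bform, Pi.add_apply] at *
    linear_combination ha + hb
  zero_mem' := by simp [Bform]
  smul_mem' := by
    intro c a ha
    simp only [Set.mem_setOf_eq, Bform, Pi.smul_apply, smul_eq_mul] at *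
    linear_combination c * ha

/-- The vector of the web with parameters `(x, y, z, w)`. -/
def webVec {F : Type} [Field F] (p : F × F × F × F) : Fin 6 → F :=
  ![0, p.1, p.2.1, p.2.2.1, p.2.2.2, p.2.2.1]

lemma webVec_smul {F : Type} [Field F] (c : F) (p : F × F × F × F) :
    webVec (c • p) = c • webVec p := by
  funext i; fin_cases i <;> simp [webVec]

lemma webVec_inj {F : Type} [Field F] {p r : F × F × F × F} (h : webVec p = webVec r) :
    p = r := by
  obtain ⟨x, y, z, w⟩ := p
  obtain ⟨x', y', z', w'⟩ := r
  have h1 := congrFun h 1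
  have h2 := congrFun h 2
  have h3 := congrFun h 3
  have h4 := congrFun h 4
  simp [webVec] at h1 h2 h3 h4
  simp [h1, h2, h3, h4]

lemma webVec_zero {F : Type} [Field F] : webVec (0 : F × F × F × F) = 0 := by
  funext i; fin_cases i <;> simp [webVec]

lemma mem_web {F : Type} [Field F] (a : Fin 6 → F) :
    a ∈ Submodule.span F ({![0, 1, 0, 0, 0, 0], ![0, 0, 1, 0, 0, 0],
      ![0, 0, 0, 0, 1, 0], ![0, 0, 0, 1, 0, 1]} : Set (Fin 6 → F)) ↔ ∃ p, a = webVec p := by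
  simp only [Submodule.mem_span_insert, Submodule.mem_span_singleton]
  constructor
  · rintro ⟨x, _, ⟨y, _, ⟨w, _, ⟨z, rfl⟩, rfl⟩, rfl⟩, rfl⟩
    refine ⟨(x, y, z, w), ?_⟩
    funext i; fin_cases i <;> simp [webVec]
  · rintro ⟨⟨x, y, z, w⟩, rfl⟩
    refine ⟨x, _, ⟨y, _, ⟨w, _, ⟨z, rfl⟩, rfl⟩, rfl⟩, ?_⟩
    funext i; fin_cases i <;> simp [webVec]

open Classical in
/-- Number of parameters satisfying `Q`. -/
noncomputable def cnt {α : Type} [Fintype α] (Q : α → Prop) : ℕ := (Finset.univ.filter Q).card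

lemma cnt_eq {α : Type} [Fintype α] (Q : α → Prop) [DecidablePred Q] :
    (Finset.univ.filter Q).card = cnt Q := by
  unfold cnt; congr

open Classical in
lemma numConics_mul {F : Type} [Field F] [Fintype F] (W : Submodule F (Fin 6 → F))
    (hW : ∀ a, a ∈ W ↔ ∃ p, a = webVec p) (T : (Fin 6 → F) → Prop)
    (Q : F × F × F × F → Prop) (hT : ∀ p, p ≠ 0 → (T (webVec p) ↔ Q p))
    (h0 : ¬ Q 0) (hQ : ∀ (c : F) p, c ≠ 0 → Q p → Q (c • p)) :
    numConics W T * (Fintype.card F - 1) = (Finset.univ.filter Q).card := by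
  set S := Finset.univ.filter Q with hS
  let f : F × F × F × F → Submodule F (Fin 6 → F) := fun p => Submodule.span F {webVec p}
  have hset : {P : Submodule F (Fin 6 → F) |
      ∃ a : Fin 6 → F, a ≠ 0 ∧ a ∈ W ∧ T a ∧ P = Submodule.span F {a}} = ↑(S.image f) := by
    ext P
    simp only [Set.mem_setOf_eq, Finset.coe_image, Set.mem_image, Finset.mem_coe, hS,
      Finset.mem_filter, Finset.mem_univ, true_and, f]
    constructor
    · rintro ⟨a, ha0, haW, hTa, rfl⟩
      obtain ⟨p, rfl⟩ := (hW a).1 haW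
      refine ⟨p, (hT p ?_).1 hTa, rfl⟩
      rintro rfl
      exact ha0 webVec_zero
    · rintro ⟨p, hp, rfl⟩
      have hp0 : p ≠ 0 := by rintro rfl; exact h0 hp
      refine ⟨webVec p, ?_, (hW _).2 ⟨p, rfl⟩, (hT p hp0).2 hp, rfl⟩
      intro h
      exact hp0 (webVec_inj (h.trans webVec_zero.symm))
  unfold numConics
  rw [hset, Set.ncard_coe_finset, Finset.card_eq_sum_card_image f S,
    Finset.sum_const_nat (m := Fintype.card F - 1)]
  intro P hP
  obtain ⟨p, hp, rfl⟩ := Finset.mem_image.1 hP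
  have hp' : Q p := by simpa [hS] using hp
  have hp0 : p ≠ 0 := by rintro rfl; exact h0 hp'
  have : (S.filter fun r => f r = f p) = ((Finset.univ : Finset F).erase 0).image (fun c => c • p) := by
    ext r
    simp only [hS, f, Finset.mem_filter, Finset.mem_univ, true_and, Finset.mem_image,
      Finset.mem_erase, and_true]
    constructor
    · rintro ⟨_, h⟩
      obtain ⟨u, hu⟩ := Submodule.span_singleton_eq_span_singleton.1 h.symm
      refine ⟨u, u.ne_zero, webVec_inj ?_⟩
      rw [webVec_smul]; exact hu
    · rintro ⟨c, hc, rfl⟩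
      refine ⟨hQ c p hc hp', ?_⟩
      rw [webVec_smul]
      exact Submodule.span_singleton_smul_eq (IsUnit.mk0 c hc) _
  rw [this, Finset.card_image_of_injective, Finset.card_erase_of_mem (Finset.mem_univ _),
    Finset.card_univ]
  intro c d h
  exact smul_left_injective F hp0 h

/-- Singularity in parameters. -/
def QS {F : Type} [Field F] (p : F × F × F × F) : Prop :=
  p.1 * p.2.1 * p.2.2.2 = p.2.2.1 * (p.1 ^ 2 + p.2.1 ^ 2)

/-- Double lines in parameters (zero included). -/
def QD {F : Type} [Field F] (p : F × F × F × F) : Prop :=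
  p.1 = 0 ∧ p.2.1 = 0 ∧ p.2.2.2 ^ 2 - 4 * p.2.2.1 ^ 2 = 0

/-- Imaginary pairs in parameters. -/
def QI {F : Type} [Field F] (p : F × F × F × F) : Prop :=
  p.1 = 0 ∧ p.2.1 = 0 ∧ ¬ IsSquare (p.2.2.2 ^ 2 - 4 * p.2.2.1 ^ 2)

lemma disc_webVec {F : Type} [Field F] (p : F × F × F × F) : disc (webVec p) = 0 ↔ QS p := by
  obtain ⟨x, y, z, w⟩ := p
  simp only [disc, webVec, QS]
  simp
  constructor <;> intro h <;> linear_combination h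

lemma webVec_eq_iff {F : Type} [Field F] (x y z w : F) (b c : Fin 3 → F) :
    webVec (x, y, z, w) = mulLin b c ↔
      b 0 * c 0 = 0 ∧ x = b 0 * c 1 + b 1 * c 0 ∧ y = b 0 * c 2 + b 2 * c 0 ∧
      z = b 1 * c 1 ∧ w = b 1 * c 2 + b 2 * c 1 ∧ z = b 2 * c 2 := by
  constructor
  · intro h
    have h0 := congrFun h 0
    have h1 := congrFun h 1
    have h2 := congrFun h 2
    have h3 := congrFun h 3
    have h4 := congrFun h 4
    have h5 := congrFun h 5
    simp [webVec, mulLin] at h0 h1 h2 h3 h4 h5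
    simp only [mul_eq_zero]
    exact ⟨h0, h1, h2, h3, h4, h5⟩
  · rintro ⟨h0, h1, h2, h3, h4, h5⟩
    funext i
    fin_cases i
    · simpa [webVec, mulLin] using h0
    · simpa [webVec, mulLin] using h1
    · simpa [webVec, mulLin] using h2
    · simpa [webVec, mulLin] using h3
    · simpa [webVec, mulLin] using h4
    · simpa [webVec, mulLin] using h5

lemma factor_iff {F : Type} [Field F] (h2 : (2 : F) ≠ 0) (p : F × F × F × F) :
    (∃ b c : Fin 3 → F, webVec p = mulLin b c) ↔ QS p ∧ ¬ QI p := by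
  obtain ⟨x, y, z, w⟩ := p
  constructor
  · rintro ⟨b, c, h⟩
    have h' := h
    rw [webVec_eq_iff] at h
    obtain ⟨e0, e1, e2, e3, e4, e5⟩ := h
    refine ⟨?_, ?_⟩
    · rw [← disc_webVec, h']
      simp [disc, mulLin]; ring
    · rintro ⟨_, _, h⟩
      apply h
      refine ⟨b 1 * c 2 - b 2 * c 1, ?_⟩
      have : z ^ 2 = (b 1 * c 1) * (b 2 * c 2) := by rw [← e3, ← e5]; ring
      simp only [this]
      rw [e4]; ring
  · rintro ⟨hS, hI⟩
    simp only [QS, QI] at hS hI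
    by_cases hx : x = 0
    · by_cases hy : y = 0
      · subst hx hy
        have : IsSquare (w ^ 2 - 4 * z ^ 2) := by
          by_contra h
          exact hI ⟨rfl, rfl, h⟩
        obtain ⟨s, hs⟩ := this
        by_cases hz : z = 0
        · refine ⟨![0, w, 0], ![0, 0, 1], ?_⟩
          rw [webVec_eq_iff]; simp [hz]
        · refine ⟨![0, z, (w - s) / 2], ![0, 1, (w + s) / (2 * z)], ?_⟩
          rw [webVec_eq_iff]
          simp
          constructor
          · field_simp; ring
          · field_simp; linear_combination -hs
      · subst hx
        have hz : z = 0 := by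
          have : z * y ^ 2 = 0 := by linear_combination -hS
          simpa [hy] using this
        refine ⟨![0, 0, 1], ![y, w, 0], ?_⟩
        rw [webVec_eq_iff]; simp [hz]
    · by_cases hy : y = 0
      · subst hy
        have hz : z = 0 := by
          have : z * x ^ 2 = 0 := by linear_combination -hS
          simpa [hx] using this
        refine ⟨![0, 1, 0], ![x, 0, w], ?_⟩
        rw [webVec_eq_iff]; simp [hz]
      · refine ⟨![0, x, y], ![1, z / x, z / y], ?_⟩
        rw [webVec_eq_iff]
        simp
        refine ⟨?_, ?_, ?_⟩
        · field_simp
        · field_simp; linear_combination hS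
        · field_simp

lemma prop_of_minors {F : Type} [Field F] (b c : Fin 3 → F) (h01 : b 0 * c 1 = b 1 * c 0)
    (h02 : b 0 * c 2 = b 2 * c 0) (h12 : b 1 * c 2 = b 2 * c 1) (hb : b ≠ 0) :
    ∃ t : F, c = t • b := by
  obtain ⟨i, hi⟩ := Function.ne_iff.1 hb
  refine ⟨c i / b i, ?_⟩
  funext j
  simp only [Pi.zero_apply] at hi
  simp only [Pi.smul_apply, smul_eq_mul]
  field_simp
  fin_cases i <;> fin_cases j <;> simp <;> first | linear_combination h01 | linear_combination -h01 | linear_combination h02 | linear_combination -h02 | linear_combination h12 | linear_combination -h12 | ring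

lemma QD_iff_minors {F : Type} [Field F] {x y z w : F} {b c : Fin 3 → F}
    (h : webVec (x, y, z, w) = mulLin b c) :
    QD (x, y, z, w) ↔ (b 0 * c 1 = b 1 * c 0 ∧ b 0 * c 2 = b 2 * c 0 ∧ b 1 * c 2 = b 2 * c 1) := by
  rw [webVec_eq_iff] at h
  obtain ⟨e0, e1, e2, e3, e4, e5⟩ := h
  have hx : x ^ 2 = (b 0 * c 1 - b 1 * c 0) ^ 2 := by
    rw [e1]; linear_combination 4 * (b 1 * c 1) * e0
  have hy : y ^ 2 = (b 0 * c 2 - b 2 * c 0) ^ 2 := by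
    rw [e2]; linear_combination 4 * (b 2 * c 2) * e0
  have hz : z ^ 2 = (b 1 * c 1) * (b 2 * c 2) := by rw [← e3, ← e5]; ring
  have hw : w ^ 2 - 4 * z ^ 2 = (b 1 * c 2 - b 2 * c 1) ^ 2 := by rw [hz, e4]; ring
  simp only [QD]
  rw [← sub_eq_zero (a := b 0 * c 1), ← sub_eq_zero (a := b 0 * c 2),
    ← sub_eq_zero (a := b 1 * c 2), ← sq_eq_zero_iff (a := b 0 * c 1 - _),
    ← sq_eq_zero_iff (a := b 0 * c 2 - _), ← sq_eq_zero_iff (a := b 1 * c 2 - _),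
    ← hx, ← hy, ← hw, sq_eq_zero_iff, sq_eq_zero_iff]

lemma real_iff {F : Type} [Field F] (h2 : (2 : F) ≠ 0) (p : F × F × F × F) :
    IsRealPair (webVec p) ↔ QS p ∧ ¬ QI p ∧ ¬ QD p := by
  rw [← and_assoc, ← factor_iff h2]
  obtain ⟨x, y, z, w⟩ := p
  constructor
  · rintro ⟨b, c, h1, h2, h⟩
    refine ⟨⟨b, c, h⟩, ?_⟩
    rw [QD_iff_minors h]
    rintro ⟨h01, h02, h12⟩
    by_cases hb : b = 0
    · exact h2 ⟨0, by simp [hb]⟩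
    · exact h1 (prop_of_minors b c h01 h02 h12 hb)
  · rintro ⟨⟨b, c, h⟩, hD⟩
    rw [QD_iff_minors h] at hD
    refine ⟨b, c, ?_, ?_, h⟩
    · rintro ⟨t, rfl⟩
      apply hD
      simp only [Pi.smul_apply, smul_eq_mul]
      refine ⟨?_, ?_, ?_⟩ <;> ring
    · rintro ⟨t, rfl⟩
      apply hD
      simp only [Pi.smul_apply, smul_eq_mul]
      refine ⟨?_, ?_, ?_⟩ <;> ring

lemma double_iff {F : Type} [Field F] (p : F × F × F × F) (hp : p ≠ 0) :
    IsDoubleLine (webVec p) ↔ QD p := by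
  obtain ⟨x, y, z, w⟩ := p
  constructor
  · rintro ⟨c, l, hc, hl, h⟩
    have h' : webVec (x, y, z, w) = mulLin (c • l) l := by
      rw [h]; funext i; fin_cases i <;> simp [mulLin] <;> ring
    rw [QD_iff_minors h']
    simp only [Pi.smul_apply, smul_eq_mul]
    refine ⟨?_, ?_, ?_⟩ <;> ring
  · rintro ⟨hx, hy, h⟩
    simp only at hx hy h
    subst hx hy
    have h' : (w - 2 * z) * (w + 2 * z) = 0 := by linear_combination h
    have hz : z ≠ 0 := by
      rintro rfl
      have : w = 0 := by simpa using h
      exact hp (by simp [this])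
    rcases mul_eq_zero.1 h' with h | h
    · have hw : w = 2 * z := by linear_combination h
      refine ⟨z, ![0, 1, 1], hz, ?_, ?_⟩
      · intro h; simpa using congrFun h 1
      · funext i; fin_cases i <;> simp [mulLin, webVec, hw] <;> ring
    · have hw : w = -(2 * z) := by linear_combination h
      refine ⟨z, ![0, 1, -1], hz, ?_, ?_⟩
      · intro h; simpa using congrFun h 1
      · funext i; fin_cases i <;> simp [mulLin, webVec, hw] <;> ring

lemma imag_iff {F : Type} [Field F] (h2 : (2 : F) ≠ 0) (p : F × F × F × F) :
    IsImagPair (webVec p) ↔ QI p := by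
  unfold IsImagPair
  rw [factor_iff h2, disc_webVec]
  constructor
  · rintro ⟨h, h'⟩
    by_contra h''
    exact h' ⟨h, h''⟩
  · intro h
    refine ⟨?_, fun h' => h'.2 h⟩
    simp [QS, h.1, h.2.1]

open Classical in
lemma card_nonsq {F : Type} [Field F] [Fintype F] (h2 : ringChar F ≠ 2) :
    2 * (Finset.univ.filter fun a : F => ¬ IsSquare a).card = Fintype.card F - 1 := by
  have hs := quadraticChar_sum_zero h2
  have key : ∀ a : F, quadraticChar F a =
      1 - (if a = 0 then 1 else 0) - 2 * (if ¬ IsSquare a then 1 else 0) := by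
    intro a
    by_cases ha : a = 0
    · subst ha; simp
    · by_cases hq : IsSquare a
      · simp [ha, hq, (quadraticChar_one_iff_isSquare ha).2 hq]
      · simp [ha, hq, (quadraticChar_neg_one_iff_not_isSquare).2 hq]
  simp_rw [key] at hs
  rw [Finset.sum_sub_distrib, Finset.sum_sub_distrib, ← Finset.mul_sum, Finset.sum_boole,
    Finset.sum_boole] at hs
  have h1 : cnt (fun a : F => a = 0) = 1 := by
    rw [← cnt_eq, Finset.card_eq_one]
    exact ⟨0, by ext a; simp⟩
  simp only [cnt_eq] at hs ⊢
  rw [h1, Finset.sum_const, Finset.card_univ, nsmul_eq_mul, mul_one] at hs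
  have : 0 < Fintype.card F := Fintype.card_pos
  push_cast at hs
  omega

open Classical in
lemma card_QI {F : Type} [Field F] [Fintype F] (h2 : ringChar F ≠ 2) :
    2 * (Finset.univ.filter (QI (F := F))).card = (Fintype.card F - 1) * (Fintype.card F - 1) := by
  have h2' : (2 : F) ≠ 0 := Ring.two_ne_zero h2
  have h4' : (4 : F) ≠ 0 := by
    have : (4 : F) = 2 * 2 := by norm_num
    rw [this]; exact mul_ne_zero h2' h2'
  have : (Finset.univ.filter (QI (F := F))) =
      (((Finset.univ : Finset F).erase 0) ×ˢ (Finset.univ.filter fun a : F => ¬ IsSquare a)).image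
        (fun r : F × F => ((0 : F), (0 : F), (r.1 * r.2 - r.1) / 4, (r.1 * r.2 + r.1) / 2)) := by
    ext ⟨x, y, z, w⟩
    simp only [Finset.mem_filter, Finset.mem_univ, true_and, QI, Finset.mem_image,
      Finset.mem_product, Finset.mem_erase, and_true, Prod.mk.injEq, Prod.exists]
    constructor
    · rintro ⟨rfl, rfl, h⟩
      have hu : w - 2 * z ≠ 0 := by
        intro h0
        apply h
        refine ⟨0, ?_⟩
        linear_combination (w + 2 * z) * h0
      refine ⟨w - 2 * z, (w + 2 * z) / (w - 2 * z), ⟨hu, ?_⟩, rfl, rfl, ?_, ?_⟩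
      · rintro ⟨s, hs⟩
        apply h
        refine ⟨(w - 2 * z) * s, ?_⟩
        field_simp at hs
        linear_combination (w - 2 * z) * hs
      · rw [mul_div_cancel₀ _ hu]; field_simp; ring
      · rw [mul_div_cancel₀ _ hu]; field_simp; ring
    · rintro ⟨u, v, ⟨hu, hv⟩, rfl, rfl, rfl, rfl⟩
      refine ⟨rfl, rfl, ?_⟩
      rintro ⟨s, hs⟩
      apply hv
      refine ⟨s / u, ?_⟩
      have e : ((u * v + u) / 2) ^ 2 - 4 * ((u * v - u) / 4) ^ 2 = u ^ 2 * v := by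
        have : (4 : F) = 2 * 2 := by norm_num
        rw [this]; field_simp; ring
      rw [e] at hs
      field_simp
      linear_combination hs
  rw [this, Finset.card_image_of_injOn, Finset.card_product,
    Finset.card_erase_of_mem (Finset.mem_univ _), Finset.card_univ, ← card_nonsq h2]
  · ring
  · rintro ⟨u, v⟩ h ⟨u', v'⟩ h' e
    simp only [Finset.coe_product, Set.mem_prod, Finset.mem_coe, Finset.mem_erase] at h h'
    simp only [Prod.mk.injEq, true_and] at e
    obtain ⟨e1, e2⟩ := e
    have hu : u = u' := by
      field_simp at e1 e2
      apply mul_left_cancel₀ h2'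
      linear_combination e2 - e1
    subst hu
    have hu0 := h.1.1
    field_simp at e2
    have : u * v = u * v' := by linear_combination u * e2
    rw [mul_left_cancel₀ hu0 this]

open Classical in
lemma card_QD {F : Type} [Field F] [Fintype F] (h2 : (2 : F) ≠ 0) :
    (Finset.univ.filter (fun p : F × F × F × F => QD p ∧ p ≠ 0)).card =
      2 * (Fintype.card F - 1) := by
  have : (Finset.univ.filter (fun p : F × F × F × F => QD p ∧ p ≠ 0)) =
      ((Finset.univ : Finset F).erase 0).image (fun z => ((0 : F), (0 : F), z, 2 * z)) ∪
      ((Finset.univ : Finset F).erase 0).image (fun z => ((0 : F), (0 : F), z, -(2 * z))) := by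
    ext ⟨x, y, z, w⟩
    simp only [Finset.mem_filter, Finset.mem_univ, true_and, Finset.mem_union,
      Finset.mem_image, Finset.mem_erase, and_true, Prod.mk.injEq]
    simp only [QD]
    constructor
    · rintro ⟨⟨rfl, rfl, h⟩, h0⟩
      have hz : z ≠ 0 := by
        rintro rfl
        have : w = 0 := by simpa using h
        exact h0 (by simp [this])
      have h' : (w - 2 * z) * (w + 2 * z) = 0 := by linear_combination h
      rcases mul_eq_zero.1 h' with h | h
      · exact Or.inl ⟨z, hz, rfl, rfl, rfl, by linear_combination -h⟩
      · exact Or.inr ⟨z, hz, rfl, rfl, rfl, by linear_combination -h⟩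
    · rintro (⟨z, hz, rfl, rfl, rfl, rfl⟩ | ⟨z, hz, rfl, rfl, rfl, rfl⟩)
      · refine ⟨⟨rfl, rfl, by ring⟩, fun h => hz ?_⟩
        simpa using congrArg (fun p => p.2.2.1) h
      · refine ⟨⟨rfl, rfl, by ring⟩, fun h => hz ?_⟩
        simpa using congrArg (fun p => p.2.2.1) h
  rw [this, Finset.card_union_of_disjoint, Finset.card_image_of_injective,
    Finset.card_image_of_injective, Finset.card_erase_of_mem (Finset.mem_univ _),
    Finset.card_univ]
  · ring
  · intro a b h; simp at h; exact h.1
  · intro a b h; simp at h; exact h.1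
  · rw [Finset.disjoint_left]
    intro p hp hp'
    simp only [Finset.mem_image, Finset.mem_erase, Finset.mem_univ, and_true] at hp hp'
    obtain ⟨z, hz, rfl⟩ := hp
    obtain ⟨z', hz', h⟩ := hp'
    simp only [Prod.mk.injEq, true_and] at h
    obtain ⟨rfl, h⟩ := h
    have : 2 * (2 * z') = 0 := by linear_combination -h
    simp [h2, hz'] at this

open Classical in
lemma card_QS {F : Type} [Field F] [Fintype F] :
    (Finset.univ.filter (QS (F := F))).card =
      Fintype.card F ^ 2 + (Fintype.card F ^ 2 - 1) * Fintype.card F := by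
  have : (Finset.univ.filter (QS (F := F))) =
      (Finset.univ : Finset (F × F)).image (fun r => ((0 : F), (0 : F), r.1, r.2)) ∪
      (((Finset.univ : Finset (F × F)).erase 0) ×ˢ (Finset.univ : Finset F)).image
        (fun r => (r.1.1, r.1.2, r.2 * (r.1.1 * r.1.2), r.2 * (r.1.1 ^ 2 + r.1.2 ^ 2))) := by
    ext ⟨x, y, z, w⟩
    simp only [Finset.mem_filter, Finset.mem_univ, true_and, QS, Finset.mem_union,
      Finset.mem_image, Finset.mem_erase, and_true, Prod.mk.injEq, Finset.mem_product,
      Prod.exists]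
    constructor
    · intro h
      by_cases h0 : x = 0 ∧ y = 0
      · left; exact ⟨z, w, h0.1.symm, h0.2.symm, rfl, rfl⟩
      · right
        have h0' : (x, y) ≠ (0 : F × F) := fun h => h0 (by simpa using h)
        by_cases hxy : x * y = 0
        · have hs : x ^ 2 + y ^ 2 ≠ 0 := by
            rcases mul_eq_zero.1 hxy with h | h <;> simpa [h] using h0
          have hz : z = 0 := by
            rw [hxy, zero_mul] at h
            exact (mul_eq_zero.1 h.symm).resolve_right hs
          exact ⟨x, y, w / (x ^ 2 + y ^ 2), h0', rfl, rfl, by rw [hxy, hz, mul_zero],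
            div_mul_cancel₀ _ hs⟩
        · refine ⟨x, y, z / (x * y), h0', rfl, rfl, div_mul_cancel₀ _ hxy, ?_⟩
          rw [div_mul_eq_mul_div, ← h, mul_div_cancel_left₀ _ hxy]
    · rintro (⟨z, w, rfl, rfl, rfl, rfl⟩ | ⟨x, y, t, _, rfl, rfl, rfl, rfl⟩) <;> ring
  rw [this, Finset.card_union_of_disjoint, Finset.card_image_of_injective,
    Finset.card_image_of_injOn, Finset.card_product, Finset.card_erase_of_mem (Finset.mem_univ _),
    Finset.card_univ, Finset.card_univ, Fintype.card_prod]
  · ring_nf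
  · rintro ⟨⟨x, y⟩, t⟩ h ⟨⟨x', y'⟩, t'⟩ h' e
    simp only [Finset.coe_product, Set.mem_prod, Finset.mem_coe, Finset.mem_erase] at h h'
    simp only [Prod.mk.injEq] at e
    obtain ⟨rfl, rfl, e1, e2⟩ := e
    have h0 : ¬ (x = 0 ∧ y = 0) := fun h'' => h.1.1 (by simp [h''])
    congr 1
    by_cases hxy : x * y = 0
    · have hs : x ^ 2 + y ^ 2 ≠ 0 := by
        rcases mul_eq_zero.1 hxy with h | h <;> simpa [h] using h0
      exact mul_right_cancel₀ hs e2
    · exact mul_right_cancel₀ hxy e1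
  · rintro ⟨a, b⟩ ⟨c, d⟩ h
    simpa using h
  · rw [Finset.disjoint_left]
    intro p hp hp'
    simp only [Finset.mem_image, Finset.mem_erase, Finset.mem_univ, and_true, true_and,
      Finset.mem_product] at hp hp'
    obtain ⟨r, rfl⟩ := hp
    obtain ⟨⟨⟨x, y⟩, t⟩, hz, h⟩ := hp'
    simp only [Prod.mk.injEq] at h
    exact hz (by simp [h.1, h.2.1])

lemma QS_smul {F : Type} [Field F] (c : F) (p : F × F × F × F) (hc : c ≠ 0) :
    QS (c • p) ↔ QS p := by
  simp only [QS, Prod.smul_fst, Prod.smul_snd, smul_eq_mul]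
  have h3 : c ^ 3 ≠ 0 := pow_ne_zero _ hc
  constructor
  · intro h; apply mul_left_cancel₀ h3; linear_combination h
  · intro h; linear_combination c ^ 3 * h

lemma QD_smul {F : Type} [Field F] (c : F) (p : F × F × F × F) (hc : c ≠ 0) :
    QD (c • p) ↔ QD p := by
  simp only [QD, Prod.smul_fst, Prod.smul_snd, smul_eq_mul, mul_eq_zero, hc, false_or]
  have h3 : c ^ 2 ≠ 0 := pow_ne_zero _ hc
  have : (c * p.2.2.2) ^ 2 - 4 * (c * p.2.2.1) ^ 2 = c ^ 2 * (p.2.2.2 ^ 2 - 4 * p.2.2.1 ^ 2) := by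
    ring
  rw [this, mul_eq_zero]
  simp [hc]

lemma QI_smul {F : Type} [Field F] (c : F) (p : F × F × F × F) (hc : c ≠ 0) :
    QI (c • p) ↔ QI p := by
  simp only [QI, Prod.smul_fst, Prod.smul_snd, smul_eq_mul, mul_eq_zero, hc, false_or]
  have : IsSquare ((c * p.2.2.2) ^ 2 - 4 * (c * p.2.2.1) ^ 2) ↔
      IsSquare (p.2.2.2 ^ 2 - 4 * p.2.2.1 ^ 2) := by
    constructor
    · rintro ⟨s, hs⟩
      refine ⟨s / c, ?_⟩
      field_simp
      linear_combination hs
    · rintro ⟨s, hs⟩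
      exact ⟨c * s, by linear_combination c ^ 2 * hs⟩
  rw [this]

open Classical in
lemma card_real {F : Type} [Field F] [Fintype F] :
    (Finset.univ.filter (fun p : F × F × F × F => QS p ∧ ¬ QI p ∧ ¬ QD p)).card +
    (Finset.univ.filter (QI (F := F))).card +
    (Finset.univ.filter (fun p : F × F × F × F => QD p ∧ p ≠ 0)).card + 1 =
    (Finset.univ.filter (QS (F := F))).card := by
  have hIS : ∀ p : F × F × F × F, QI p → QS p := fun p h => by simp [QS, h.1, h.2.1]
  have hDS : ∀ p : F × F × F × F, QD p → QS p := fun p h => by simp [QS, h.1, h.2.1]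
  have hDI : ∀ p : F × F × F × F, QD p → ¬ QI p := fun p h h' => h'.2.2 (by rw [h.2.2]; simp)
  have h0 : QD (0 : F × F × F × F) := by simp [QD]
  have h1 : (Finset.univ.filter (fun p : F × F × F × F => p = 0)).card = 1 := by
    rw [Finset.filter_eq']; simp
  rw [← h1]
  simp only [Finset.card_filter]
  rw [← Finset.sum_add_distrib, ← Finset.sum_add_distrib, ← Finset.sum_add_distrib]
  refine Finset.sum_congr rfl fun p _ => ?_
  by_cases hp : p = 0
  · subst hp
    simp [h0, hDI _ h0, hDS _ h0]
  · by_cases hD : QD p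
    · simp [hD, hDI _ hD, hDS _ hD, hp]
    · by_cases hI : QI p
      · simp [hD, hI, hIS _ hI, hp]
      · simp [hD, hI, hp]

/-- conic counts of the web `(X0X1, X0X2, X1X2, X1^2 + X2^2)`
(line-orbit `o_{8,1}`), `q` odd. -/
theorem web_o81_conic_counts (F : Type) [Field F] [Fintype F] (q : ℕ)
    (hq : Fintype.card F = q) (hodd : Odd q) (W : Submodule F (Fin 6 → F))
    (hW : W = Submodule.span F ({![0, 1, 0, 0, 0, 0], ![0, 0, 1, 0, 0, 0],
      ![0, 0, 0, 0, 1, 0], ![0, 0, 0, 1, 0, 1]} : Set (Fin 6 → F))) :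
    numConics W IsDoubleLine = 2 ∧
    numConics W IsRealPair = q ^ 2 + (3 * q - 1) / 2 ∧
    numConics W IsImagPair = (q - 1) / 2 ∧
    numConics W IsNonsingular = q ^ 3 - q := by
  subst hq
  have hW' : ∀ a, a ∈ W ↔ ∃ p, a = webVec p := by
    intro a; rw [hW]; exact mem_web a
  have hchar : ringChar F ≠ 2 := by
    intro h
    have := FiniteField.even_card_of_char_two h
    obtain ⟨k, hk⟩ := hodd
    omega
  have h2 : (2 : F) ≠ 0 := Ring.two_ne_zero hchar
  classical
  have hD := numConics_mul W hW' IsDoubleLine (fun p => QD p ∧ p ≠ 0)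
    (fun p hp => by rw [double_iff p hp]; simp [hp]) (by simp)
    (fun c p hc h => ⟨(QD_smul c p hc).2 h.1, smul_ne_zero hc h.2⟩)
  have hR := numConics_mul W hW' IsRealPair (fun p => QS p ∧ ¬ QI p ∧ ¬ QD p)
    (fun p hp => real_iff h2 p) (by simp [QD])
    (fun c p hc h => by rwa [QS_smul c p hc, QI_smul c p hc, QD_smul c p hc])
  have hI := numConics_mul W hW' IsImagPair QI
    (fun p hp => imag_iff h2 p) (by simp [QI])
    (fun c p hc h => by rwa [QI_smul c p hc])
  have hN := numConics_mul W hW' IsNonsingular (fun p => ¬ QS p)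
    (fun p hp => by rw [IsNonsingular, Ne, disc_webVec]) (by simp [QS])
    (fun c p hc h => by rwa [QS_smul c p hc])
  have cI := card_QI hchar
  have cD := card_QD h2
  have cS := card_QS (F := F)
  have cR := card_real (F := F)
  have cN := Finset.card_filter_add_card_filter_not (s := Finset.univ) (QS (F := F))
  rw [Finset.card_univ, Fintype.card_prod, Fintype.card_prod, Fintype.card_prod] at cN
  have hc1 : 1 < Fintype.card F := Fintype.one_lt_card
  simp only [cnt_eq] at hD hR hI hN cI cD cS cR cN
  obtain ⟨k, hk⟩ := hodd
  rw [hk] at hD hR hI hN cI cD cS cN hc1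
  simp only [hk]
  have hk0 : 0 < k := by omega
  have e1 : 2 * k + 1 - 1 = 2 * k := by omega
  have e2 : (2 * k + 1) ^ 2 - 1 = 4 * k * (k + 1) := by
    have : (2 * k + 1) ^ 2 = 4 * k * (k + 1) + 1 := by ring
    omega
  have e3 : (2 * k + 1) ^ 3 - (2 * k + 1) = (2 * k + 1) * (4 * k * (k + 1)) := by
    have : (2 * k + 1) ^ 3 = (2 * k + 1) * (4 * k * (k + 1)) + (2 * k + 1) := by ring
    omega
  have e4 : (3 * (2 * k + 1) - 1) / 2 = 3 * k + 1 := by omega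
  have e5 : (2 * k + 1 - 1) / 2 = k := by omega
  rw [e1] at hD hR hI hN cI cD
  rw [e2] at cS
  rw [e3, e4, e5]
  have h2k : 0 < 2 * k := by omega
  refine ⟨?_, ?_, ?_, ?_⟩
  · apply Nat.eq_of_mul_eq_mul_right h2k
    linarith
  · apply Nat.eq_of_mul_eq_mul_right h2k
    linarith
  · apply Nat.eq_of_mul_eq_mul_right h2k
    linarith
  · apply Nat.eq_of_mul_eq_mul_right h2k
    linarith
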